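/- For every k and every ε > 0 there exists a constant c(k,ε) (not depending on n) and N such that for all n ≥ N the following holds: if ([n],{Π_s}) is an instance of quantum k-SAT that is ε-far from satisfiable by a product state, then the number of subsets C ∈ σ_{c(k,ε)}([n]) at which the instance is locally unsatisfiable by a product state is greater than 0.75·C(n,c(k,ε)); that is, a uniformly random C ∈ σ_{c(k,ε)}([n]) is locally unsatisfiable by a product state with probability greater than 0.75. -/

import Mathlib

open scoped Classical

namespace QkSAT

/-- The Hilbert space of the qubits indexed by the subset `C` of `[n]`,
with basis indexed by bit strings on `C`. -/
abbrev QVec (n : ℕ) (C : Finset (Fin n)) : Type := (↥C → Fin 2) → ℂ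

/-- Extend an operator acting on the qubits in `s` to an operator on the qubits of `C ⊇ s`
which acts trivially on the qubits outside `s`. -/
noncomputable def extendOp {n : ℕ} (s C : Finset (Fin n))
    (K : Matrix (↥s → Fin 2) (↥s → Fin 2) ℂ) :
    Matrix (↥C → Fin 2) (↥C → Fin 2) ℂ :=
  Matrix.of fun f g =>
    if hs : s ⊆ C then
      if ∀ i : ↥C, (i : Fin n) ∉ s → f i = g i then
        K (fun j => f ⟨j.1, hs j.2⟩) (fun j => g ⟨j.1, hs j.2⟩)
      else 0
    else 0

/-- An instance of quantum `k`-SAT on `n` qubits: for every `k`-element subset `s` of the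
qubits, an orthogonal projection acting nontrivially only on the qubits in `s`, specified by
its matrix on the qubits in `s`. -/
structure Instance (n k : ℕ) where
  K : (s : Finset (Fin n)) → Matrix (↥s → Fin 2) (↥s → Fin 2) ℂ
  isHermitian : ∀ s : Finset (Fin n), s.card = k → (K s).IsHermitian
  isIdempotent : ∀ s : Finset (Fin n), s.card = k → K s * K s = K s

/-- `∑_{s ∈ σ_k(C)} Π_s ψ` for a vector `ψ` on the qubits in `C`. -/
noncomputable def constraintSum {n k : ℕ} (I : Instance n k) (C : Finset (Fin n))
    (ψ : QVec n C) : QVec n C :=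
  ∑ s ∈ Finset.powersetCard k C, (extendOp s C (I.K s)).mulVec ψ

/-- The restriction of the instance to the qubits in `C` is satisfiable. -/
def SatisfiableAt {n k : ℕ} (I : Instance n k) (C : Finset (Fin n)) : Prop :=
  ∃ ψ : QVec n C, ψ ≠ 0 ∧ constraintSum I C ψ = 0

/-- The instance is satisfiable. -/
def Satisfiable {n k : ℕ} (I : Instance n k) : Prop :=
  SatisfiableAt I Finset.univ

/-- The product vector `⊗ᵢ φᵢ`. -/
def prodVec {ι : Type*} [Fintype ι] (φ : ι → (Fin 2 → ℂ)) : (ι → Fin 2) → ℂ :=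
  fun f => ∏ i, φ i (f i)

/-- The instance is locally satisfiable by a product state at `C`. -/
def ProdSatisfiableAt {n k : ℕ} (I : Instance n k) (C : Finset (Fin n)) : Prop :=
  ∃ φ : ↥C → (Fin 2 → ℂ), (∀ i, φ i ≠ 0) ∧ constraintSum I C (prodVec φ) = 0

/-- The instance is `ε`-far from satisfiable by a product state: whenever removing the
constraints indexed by `Sig` admits a (nonzero) product-state solution, `|Sig| ≥ ε n^k`. -/
def EpsFarFromProdSat {n k : ℕ} (I : Instance n k) (ε : ℝ) : Prop :=
  ∀ Sig : Finset (Finset (Fin n)),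
    (∃ φ : ↥(Finset.univ : Finset (Fin n)) → (Fin 2 → ℂ), (∀ i, φ i ≠ 0) ∧
      ∑ s ∈ Finset.powersetCard k (Finset.univ : Finset (Fin n)) \ Sig,
        (extendOp s Finset.univ (I.K s)).mulVec (prodVec φ) = 0) →
    ε * (n : ℝ) ^ k ≤ (Sig.card : ℝ)

/-- Double counting for a relation between two finite types. -/
lemma card_mul_le_of_forall_card_le {α β : Type*} [Fintype α] [Fintype β]
    (P : α → Prop) [DecidablePred P] (R : α → β → Prop) [∀ a b, Decidable (R a b)] (c C : ℝ)
    (hP : ∀ a, P a → c ≤ ((Finset.univ.filter fun b => R a b).card : ℝ))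
    (hC : ∀ b, ((Finset.univ.filter fun a => R a b).card : ℝ) ≤ C) :
    ((Finset.univ.filter P).card : ℝ) * c ≤ Fintype.card β * C := by
  have h := Finset.sum_card_bipartiteAbove_eq_sum_card_bipartiteBelow
    (s := (Finset.univ : Finset α)) (t := (Finset.univ : Finset β)) R
  have h' : (∑ a, ((Finset.univ.filter fun b => R a b).card : ℝ))
      = ∑ b, ((Finset.univ.filter fun a => R a b).card : ℝ) := by
    exact_mod_cast h
  calc ((Finset.univ.filter P).card : ℝ) * c
      = ∑ _a ∈ Finset.univ.filter P, c := by simp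
    _ ≤ ∑ a ∈ Finset.univ.filter P, ((Finset.univ.filter fun b => R a b).card : ℝ) :=
        Finset.sum_le_sum fun a ha => hP a (Finset.mem_filter.1 ha).2
    _ ≤ ∑ a, ((Finset.univ.filter fun b => R a b).card : ℝ) :=
        Finset.sum_le_univ_sum_of_nonneg fun a => by positivity
    _ = ∑ b, ((Finset.univ.filter fun a => R a b).card : ℝ) := h'
    _ ≤ ∑ _b : β, C := Finset.sum_le_sum fun b _ => hC b
    _ = Fintype.card β * C := by simp

/-- A coordinate of a uniformly random point of a finite product is uniformly distributed. -/
lemma card_filter_apply_mul {ι : Type*} [Fintype ι] [DecidableEq ι] {β : ι → Type*}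
    [∀ i, Fintype (β i)] (j : ι) (p : β j → Prop) [DecidablePred p] :
    (Finset.univ.filter fun τ : ∀ i, β i => p (τ j)).card * Fintype.card (β j)
      = (Finset.univ.filter p).card * Fintype.card (∀ i, β i) := by
  have h : (Finset.univ.filter fun τ : ∀ i, β i => p (τ j)).card
      = ((Finset.univ.filter p) ×ˢ
          (Finset.univ : Finset (∀ i : { i // i ≠ j }, β i))).card := by
    refine Finset.card_equiv (Equiv.piSplitAt j β) fun τ => ?_
    simp [Equiv.piSplitAt]
  rw [h, Finset.card_product, Fintype.card_congr (Equiv.piSplitAt j β), Fintype.card_prod,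
    Finset.card_univ]
  ring

lemma card_filter_cons {Λ : Type*} [Fintype Λ] {r : ℕ} (p : (Fin (r + 1) → Λ) → Prop)
    [DecidablePred p] :
    (Finset.univ.filter p).card
      = ∑ l : Λ, (Finset.univ.filter fun B : Fin r → Λ => p (Fin.cons l B)).card := by
  have : (Finset.univ.filter p).card = ((Finset.univ : Finset Λ).sigma fun l =>
      Finset.univ.filter fun B : Fin r → Λ => p (Fin.cons l B)).card := by
    refine Finset.card_equiv
      ((Fin.consEquiv fun _ => Λ).symm.trans (Equiv.sigmaEquivProd _ _).symm) fun B => ?_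
    simp [Fin.consEquiv]
  rw [this, Finset.card_sigma]

/-- If every point of `Z` is excluded by at least a fraction `δ` of the subspaces `N l`, then
few `r`-tuples of these subspaces have a common point in `Z`: as long as such a point exists,
each further subspace lowers the dimension of the intersection with probability at least `δ`. -/
lemma card_exists_mem_inf_mul_le {F Λ : Type*} [AddCommGroup F] [Module ℂ F]
    [FiniteDimensional ℂ F] [Fintype Λ] (N : Λ → Submodule ℂ F) (Z : Set F) (δ : ℝ)
    (hδ : 0 ≤ δ)
    (h : ∀ z ∈ Z, δ * Fintype.card Λ ≤ ((Finset.univ.filter fun l => z ∉ N l).card : ℝ))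
    (r : ℕ) (N₀ : Submodule ℂ F) :
    ((Finset.univ.filter fun B : Fin r → Λ => ∃ z ∈ Z, z ∈ N₀ ∧ ∀ i, z ∈ N (B i)).card : ℝ)
      * (r * δ) ≤ Module.finrank ℂ N₀ * (Fintype.card Λ : ℝ) ^ r := by
  induction r generalizing N₀ with
  | zero => simp
  | succ r ih =>
    by_cases hal : ∃ z ∈ Z, z ∈ N₀
    · obtain ⟨z, hz, hz0⟩ := hal
      set A := Finset.univ.filter fun B : Fin (r + 1) → Λ =>
        ∃ z ∈ Z, z ∈ N₀ ∧ ∀ i, z ∈ N (B i) with hA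
      have hcard : (A.card : ℝ) = ∑ l : Λ, ((Finset.univ.filter fun B : Fin r → Λ =>
          ∃ z ∈ Z, z ∈ N₀ ⊓ N l ∧ ∀ i, z ∈ N (B i)).card : ℝ) := by
        rw [hA, card_filter_cons]
        push_cast
        simp [Fin.forall_fin_succ, and_assoc]
      have hle : (A.card : ℝ) ≤ (Fintype.card Λ : ℝ) ^ (r + 1) := by
        have := Finset.card_le_univ A
        rw [Fintype.card_fun, Fintype.card_fin] at this
        exact_mod_cast this
      have hrank : ∀ l, (Module.finrank ℂ ↥(N₀ ⊓ N l) : ℝ)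
          ≤ Module.finrank ℂ N₀ - if z ∉ N l then 1 else 0 := by
        intro l
        by_cases hl : z ∉ N l
        · rw [if_pos hl]
          have : N₀ ⊓ N l < N₀ :=
            lt_of_le_of_ne inf_le_left fun he => hl (he.ge hz0).2
          have := Submodule.finrank_lt_finrank_of_lt this
          have : (Module.finrank ℂ ↥(N₀ ⊓ N l) : ℝ) + 1 ≤ Module.finrank ℂ N₀ := by
            exact_mod_cast this
          linarith
        · have := Submodule.finrank_mono (inf_le_left : N₀ ⊓ N l ≤ N₀)
          simpa [hl] using this
      have hsum : (A.card : ℝ) * (r * δ)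
          ≤ (Module.finrank ℂ N₀ - δ) * (Fintype.card Λ : ℝ) ^ (r + 1) := by
        rw [hcard, Finset.sum_mul]
        calc _ ≤ ∑ l : Λ, ((Module.finrank ℂ N₀ : ℝ) - if z ∉ N l then 1 else 0)
                * (Fintype.card Λ : ℝ) ^ r :=
              Finset.sum_le_sum fun l _ => (ih _).trans
                (mul_le_mul_of_nonneg_right (hrank l) (by positivity))
          _ = (Fintype.card Λ * Module.finrank ℂ N₀
                - ((Finset.univ.filter fun l => z ∉ N l).card : ℝ))
                * (Fintype.card Λ : ℝ) ^ r := by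
              rw [← Finset.sum_mul, Finset.sum_sub_distrib, Finset.sum_boole]
              simp
          _ ≤ (Fintype.card Λ * Module.finrank ℂ N₀ - δ * Fintype.card Λ)
                * (Fintype.card Λ : ℝ) ^ r :=
              mul_le_mul_of_nonneg_right (by linarith [h z hz]) (by positivity)
          _ = _ := by ring
      push_cast
      nlinarith [mul_le_mul_of_nonneg_right hle hδ]
    · have : (Finset.univ.filter fun B : Fin (r + 1) → Λ =>
          ∃ z ∈ Z, z ∈ N₀ ∧ ∀ i, z ∈ N (B i)) = ∅ :=
        Finset.filter_eq_empty_iff.2 fun B _ ⟨z, hz, hz0, _⟩ => hal ⟨z, hz, hz0⟩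
      rw [this]
      simp only [Finset.card_empty, Nat.cast_zero, zero_mul]
      positivity

/-- Whether a subspace `K` meets the span of `x, y` nontrivially (in the sense of coefficients)
is a linear condition on the alternating map `l ↦ l x • y - l y • x`. -/
lemma exists_smul_add_smul_mem_iff {H : Type*} [AddCommGroup H] [Module ℂ H]
    (K : Submodule ℂ H) (x y : H) :
    (∃ a : Fin 2 → ℂ, a ≠ 0 ∧ a 0 • x + a 1 • y ∈ K) ↔
      ∀ l ∈ K.dualAnnihilator, l x • y - l y • x ∈ K := by
  constructor
  · rintro ⟨a, ha, hK⟩ l hl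
    have h0 : a 0 * l x + a 1 * l y = 0 := by
      simpa using (Submodule.mem_dualAnnihilator l).1 hl _ hK
    by_cases h : a 0 = 0
    · have h1 : a 1 ≠ 0 := fun h1 => ha (by ext i; fin_cases i <;> simp [h, h1])
      have hy : y ∈ K := by simpa [h, K.smul_mem_iff h1] using hK
      have : l y = 0 := by simpa [h, h1] using h0
      simpa [this] using K.smul_mem _ hy
    · have : l x • y - l y • x = (-(l y / a 0)) • (a 0 • x + a 1 • y) := by
        obtain ⟨c, hc⟩ : ∃ c, l y = c * a 0 := ⟨l y / a 0, by field_simp⟩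
        have hx : l x = -c * a 1 :=
          mul_left_cancel₀ h (by linear_combination h0 - a 1 * hc)
        rw [hx, hc, mul_div_cancel_right₀ _ h]
        module
      rw [this]
      exact K.smul_mem _ hK
  · intro h
    by_cases hx : x ∈ K
    · exact ⟨![1, 0], by simp, by simpa using hx⟩
    · obtain ⟨l, hl, hK⟩ := Submodule.exists_dual_map_eq_bot_of_notMem hx inferInstance
      have hl' : l ∈ K.dualAnnihilator := (Submodule.mem_dualAnnihilator l).2 fun w hw => by
        have : l w ∈ K.map l := Submodule.mem_map_of_mem hw
        simpa [hK] using this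
      refine ⟨![-l y, l x], fun h0 => hl (by simpa using congrFun h0 1), ?_⟩
      have := h l hl'
      simpa [sub_eq_neg_add] using this

/-- Tensors on `j` qubits. -/
abbrev Tens (j : ℕ) : Type := (Fin j → Fin 2) → ℂ

/-- The bilinear map `a, ψ ↦ a ⊗ ψ`. -/
noncomputable def tens (j : ℕ) : (Fin 2 → ℂ) →ₗ[ℂ] Tens j →ₗ[ℂ] Tens (j + 1) :=
  LinearMap.mk₂ ℂ (fun a ψ f => a (f 0) * ψ (Fin.tail f))
    (fun a b ψ => by ext f; simp [add_mul])
    (fun c a ψ => by ext f; simp [mul_assoc])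
    (fun a ψ χ => by ext f; simp [mul_add])
    (fun c a ψ => by ext f; simp [mul_left_comm])

lemma tens_prodVec {j : ℕ} (φ : Fin (j + 1) → Fin 2 → ℂ) :
    tens j (φ 0) (prodVec (Fin.tail φ)) = prodVec φ := by
  ext f
  simp [tens, prodVec, Fin.prod_univ_succ, Fin.tail]

/-- For every tuple of vertices, the subspace of tensors allowed on this tuple. -/
abbrev Allowed (Ω : Type*) : Type _ := ∀ j : ℕ, (Fin j → Ω) → Submodule ℂ (Tens j)

variable {Ω : Type*}

/-- The allowed subspaces that remain after assigning the vector `p.2` to the vertex `p.1`. -/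
noncomputable def assign (V : Allowed Ω) (p : Ω × (Fin 2 → ℂ)) : Allowed Ω := fun j T =>
  V j T ⊓ (V (j + 1) (Fin.cons p.1 T)).comap (tens j p.2)

/-- The allowed subspaces that remain after assigning vectors to a list of vertices. -/
noncomputable def assignAll (V : Allowed Ω) (l : List (Ω × (Fin 2 → ℂ))) : Allowed Ω :=
  l.foldl assign V

/-- Assigning `a` to `w` puts no new constraint on the tuple `T`. -/
def Compatible (V : Allowed Ω) (j : ℕ) (w : Ω) (a : Fin 2 → ℂ) (T : Fin j → Ω) : Prop :=
  ∀ ψ ∈ V j T, tens j a ψ ∈ V (j + 1) (Fin.cons w T)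

lemma assignAll_append (V : Allowed Ω) (l l' : List (Ω × (Fin 2 → ℂ))) :
    assignAll V (l ++ l') = assignAll (assignAll V l) l' :=
  List.foldl_append

lemma assignAll_le (V : Allowed Ω) (l : List (Ω × (Fin 2 → ℂ))) : assignAll V l ≤ V := by
  induction l generalizing V with
  | nil => exact le_rfl
  | cons p l ih => exact (ih (assign V p)).trans fun j T => inf_le_left

lemma compatible_of_le_assignAll {V : Allowed Ω} {l : List (Ω × (Fin 2 → ℂ))} {j : ℕ}
    {T : Fin j → Ω} (h : V j T ≤ assignAll V l j T) {p : Ω × (Fin 2 → ℂ)} (hp : p ∈ l) :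
    Compatible V j p.1 p.2 T := by
  obtain ⟨l₁, l₂, rfl⟩ := List.append_of_mem hp
  intro ψ hψ
  have h₁ := h hψ
  rw [assignAll_append] at h₁
  have h₂ := assignAll_le (assign (assignAll V l₁) p) l₂ j T h₁
  exact assignAll_le V l₁ _ _ h₂.2

/-- A global assignment that is allowed on all tuples of vertices in `C` remains allowed after
assigning its values to vertices in `C`. -/
lemma prodVec_mem_assignAll {V : Allowed Ω} (φ : Ω → Fin 2 → ℂ) (C : Set Ω)
    (l : List (Ω × (Fin 2 → ℂ))) (hl : ∀ p ∈ l, p.1 ∈ C ∧ p.2 = φ p.1)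
    (h : ∀ j (T : Fin j → Ω), (∀ i, T i ∈ C) → prodVec (fun i => φ (T i)) ∈ V j T)
    {j : ℕ} (T : Fin j → Ω) (hT : ∀ i, T i ∈ C) :
    prodVec (fun i => φ (T i)) ∈ assignAll V l j T := by
  induction l generalizing V with
  | nil => exact h j T hT
  | cons p l ih =>
    refine ih (V := assign V p) (fun q hq => hl q (List.mem_cons_of_mem _ hq))
      fun j T hT => ⟨h j T hT, ?_⟩
    obtain ⟨hp, hφ⟩ := hl p List.mem_cons_self
    have := h (j + 1) (Fin.cons p.1 T) (Fin.cases hp hT)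
    rw [← tens_prodVec] at this
    change tens j p.2 _ ∈ V _ _
    rw [hφ]
    exact this

/-- Families consisting of one `j`-tuple of vertices for each `j < k`. -/
abbrev Tuples (k : ℕ) (Ω : Type*) : Type _ := ∀ j : Fin k, Fin j → Ω

/-- The average over `τ` of this quantity decreases whenever new constraints appear. -/
noncomputable def totalDim (k : ℕ) (V : Allowed Ω) (τ : Tuples k Ω) : ℕ :=
  ∑ j : Fin k, Module.finrank ℂ (V j (τ j))

lemma totalDim_le (k : ℕ) (V : Allowed Ω) (τ : Tuples k Ω) :
    totalDim k V τ ≤ k * 2 ^ k := by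
  calc totalDim k V τ ≤ ∑ _j : Fin k, 2 ^ k := Finset.sum_le_sum fun j _ => by
        refine (Submodule.finrank_le _).trans ?_
        simpa using Nat.pow_le_pow_right two_pos j.2.le
    _ = k * 2 ^ k := by simp

lemma totalDim_mono {k : ℕ} {V W : Allowed Ω} (h : V ≤ W) (τ : Tuples k Ω) :
    totalDim k V τ ≤ totalDim k W τ :=
  Finset.sum_le_sum fun j _ => Submodule.finrank_mono (h j (τ j))

lemma totalDim_lt {k : ℕ} {V W : Allowed Ω} (h : V ≤ W) (τ : Tuples k Ω)
    {j : Fin k} (hj : ¬ W j (τ j) ≤ V j (τ j)) : totalDim k V τ < totalDim k W τ :=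
  Finset.sum_lt_sum (fun j _ => Submodule.finrank_mono (h j (τ j)))
    ⟨j, Finset.mem_univ _, Submodule.finrank_lt_finrank_of_lt
      (lt_of_le_not_ge (h j (τ j)) hj)⟩

/-- The subspaces allowed after assigning `q` vectors are cut out by linear conditions on
features of the assignment whose number depends only on `q`. -/
lemma exists_features (q : ℕ) : ∃ d : ℕ → ℕ, ∀ (Ω : Type) (V : Allowed Ω) (S : List Ω),
    S.length = q →
    ∃ (e : List (Ω × (Fin 2 → ℂ)) → ∀ j, Tens j →ₗ[ℂ] (Fin (d j) → ℂ))
      (M : ∀ j, (Fin j → Ω) → Submodule ℂ (Fin (d j) → ℂ)),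
      ∀ l, l.map Prod.fst = S → ∀ j T χ, χ ∈ assignAll V l j T ↔ e l j χ ∈ M j T := by
  induction q with
  | zero =>
    have E : ∀ j, Nonempty (Tens j ≃ₗ[ℂ] (Fin (2 ^ j) → ℂ)) := fun j =>
      FiniteDimensional.nonempty_linearEquiv_of_finrank_eq (by simp)
    refine ⟨fun j => 2 ^ j, fun Ω V S hS => ⟨fun _ j => (E j).some,
      fun j T => (V j T).map ((E j).some : Tens j →ₗ[ℂ] _), fun l hl j T χ => ?_⟩⟩
    obtain rfl : l = [] := by
      rw [List.length_eq_zero_iff.1 hS] at hl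
      simpa using hl
    simp [assignAll]
  | succ q ih =>
    obtain ⟨d, hd⟩ := ih
    have E : ∀ j, Nonempty (((Fin (d j) → ℂ) × (Fin (d (j + 1)) → ℂ))
        ≃ₗ[ℂ] (Fin (d j + d (j + 1)) → ℂ)) := fun j =>
      FiniteDimensional.nonempty_linearEquiv_of_finrank_eq (by simp)
    refine ⟨fun j => d j + d (j + 1), fun Ω V S hS => ?_⟩
    obtain ⟨S', w, rfl⟩ := (List.eq_nil_or_concat S).resolve_left
      (by rintro rfl; simp at hS)
    obtain ⟨e, M, h⟩ := hd Ω V S' (by simpa using hS)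
    refine ⟨fun l j => (E j).some.toLinearMap ∘ₗ (e l.dropLast j).prod
        (e l.dropLast (j + 1) ∘ₗ tens j ((l.getLast?.map Prod.snd).getD 0)),
      fun j T => ((M j T).prod (M (j + 1) (Fin.cons w T))).map
        ((E j).some : _ →ₗ[ℂ] _), fun l hl j T χ => ?_⟩
    obtain ⟨l', p, rfl⟩ := (List.eq_nil_or_concat l).resolve_left
      (by rintro rfl; simp at hl)
    obtain ⟨hl', rfl⟩ : l'.map Prod.fst = S' ∧ p.1 = w := by
      simpa [List.append_inj_left'] using hl
    rw [List.concat_eq_append, assignAll_append]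
    simp [assignAll, assign, ← h l' hl']

/-- If every global assignment violates many constraints, then for many vertices `w` every value
at `w` puts new constraints on many tuples: otherwise choosing at each remaining vertex a value
that does not would violate few constraints. -/
lemma card_incompatible_ge {n k : ℕ} (hn : 0 < n) (V : Allowed (Fin n)) (ε δ : ℝ)
    (hδ : 0 ≤ δ) (hεδ : 2 * k * δ < ε)
    (h0 : (1 : Tens 0) ∈ V 0 Fin.elim0)
    (hV : ∀ φ : Fin n → Fin 2 → ℂ, (∀ i, φ i ≠ 0) → ε * (n : ℝ) ^ k ≤
      ((Finset.univ.filter fun x : Fin k → Fin n =>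
        prodVec (fun i => φ (x i)) ∉ V k x).card : ℝ)) :
    δ * n ≤ ((Finset.univ.filter fun w : Fin n => ∀ a : Fin 2 → ℂ, a ≠ 0 → ∃ j : Fin k,
      δ * (n : ℝ) ^ (j : ℕ) ≤ ((Finset.univ.filter fun T : Fin j → Fin n =>
        ¬ Compatible V j w a T).card : ℝ)).card : ℝ) := by
  set bad := Finset.univ.filter fun w : Fin n => ∀ a : Fin 2 → ℂ, a ≠ 0 → ∃ j : Fin k,
      δ * (n : ℝ) ^ (j : ℕ) ≤ ((Finset.univ.filter fun T : Fin j → Fin n =>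
        ¬ Compatible V j w a T).card : ℝ) with hbad
  by_contra! hlt
  have hφ : ∀ w : Fin n, ∃ a : Fin 2 → ℂ, a ≠ 0 ∧ (w ∉ bad → ∀ j : Fin k,
      ((Finset.univ.filter fun T : Fin j → Fin n => ¬ Compatible V j w a T).card : ℝ)
        ≤ δ * (n : ℝ) ^ (j : ℕ)) := by
    intro w
    by_cases hw : w ∈ bad
    · exact ⟨fun _ => 1, fun h => one_ne_zero (congrFun h 0), fun h => absurd hw h⟩
    · simp only [hbad, Finset.mem_filter, Finset.mem_univ, true_and] at hw
      push Not at hw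
      obtain ⟨a, ha, h⟩ := hw
      exact ⟨a, ha, fun _ j => (h j).le⟩
  choose φ hφ0 hφ using hφ
  have hfail : ∀ j ≤ k, ((Finset.univ.filter fun x : Fin j → Fin n =>
      prodVec (fun i => φ (x i)) ∉ V j x).card : ℝ) ≤ 2 * j * δ * (n : ℝ) ^ j := by
    intro j
    induction j with
    | zero =>
      intro _
      rw [Finset.filter_eq_empty_iff.2]
      · simp
      · intro T _
        have e : prodVec (fun i => φ (T i)) = 1 := by
          ext f
          simp [prodVec]
        rw [e, Subsingleton.elim T Fin.elim0, not_not]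
        exact h0
    | succ j ih =>
      intro hj
      rw [card_filter_cons]
      push_cast
      have hstep : ∀ w : Fin n, ((Finset.univ.filter fun T : Fin j → Fin n =>
          prodVec (fun i => φ ((Fin.cons w T : Fin (j + 1) → Fin n) i))
            ∉ V (j + 1) (Fin.cons w T)).card : ℝ)
          ≤ 2 * j * δ * (n : ℝ) ^ j + (δ * (n : ℝ) ^ j + if w ∈ bad then (n : ℝ) ^ j else 0) := by
        intro w
        have hsub : (Finset.univ.filter fun T : Fin j → Fin n =>
            prodVec (fun i => φ ((Fin.cons w T : Fin (j + 1) → Fin n) i))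
              ∉ V (j + 1) (Fin.cons w T)) ⊆
            (Finset.univ.filter fun T : Fin j → Fin n => prodVec (fun i => φ (T i)) ∉ V j T)
            ∪ Finset.univ.filter fun T : Fin j → Fin n => ¬ Compatible V j w (φ w) T := by
          intro T
          simp only [Finset.mem_filter, Finset.mem_univ, true_and, Finset.mem_union]
          contrapose!
          rintro ⟨h₁, h₂⟩
          rw [← tens_prodVec]
          exact h₂ _ h₁
        have hcard := (Finset.card_le_card hsub).trans (Finset.card_union_le _ _)
        have hcard' : ((Finset.univ.filter fun T : Fin j → Fin n =>
            ¬ Compatible V j w (φ w) T).card : ℝ)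
            ≤ δ * (n : ℝ) ^ j + if w ∈ bad then (n : ℝ) ^ j else 0 := by
          split_ifs with hw
          · have := Finset.card_le_univ
              (Finset.univ.filter fun T : Fin j → Fin n => ¬ Compatible V j w (φ w) T)
            rw [Fintype.card_fun, Fintype.card_fin, Fintype.card_fin] at this
            have : ((Finset.univ.filter fun T : Fin j → Fin n =>
              ¬ Compatible V j w (φ w) T).card : ℝ) ≤ (n : ℝ) ^ j := by exact_mod_cast this
            have : 0 ≤ δ * (n : ℝ) ^ j := by positivity
            linarith
          · simpa using hφ w hw ⟨j, hj⟩
        calc _ ≤ (((Finset.univ.filter fun T : Fin j → Fin n =>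
              prodVec (fun i => φ (T i)) ∉ V j T).card : ℝ)
              + ((Finset.univ.filter fun T : Fin j → Fin n =>
                ¬ Compatible V j w (φ w) T).card : ℝ)) := by exact_mod_cast hcard
          _ ≤ _ := add_le_add (ih (by omega)) hcard'
      refine (Finset.sum_le_sum fun w _ => hstep w).trans ?_
      rw [Finset.sum_add_distrib, Finset.sum_add_distrib, ← Finset.sum_filter,
        Finset.filter_mem_eq_inter, Finset.univ_inter]
      simp only [Finset.sum_const, Finset.card_univ, Fintype.card_fin, nsmul_eq_mul]
      have := mul_le_mul_of_nonneg_right hlt.le (by positivity : (0 : ℝ) ≤ (n : ℝ) ^ j)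
      rw [pow_succ]
      linarith
  have h₁ := (hV φ hφ0).trans (hfail k le_rfl)
  have : (0 : ℝ) < (n : ℝ) ^ k := by positivity
  nlinarith

/-- `w` has a nonzero value compatible with all tuples of the sample `X`. -/
def Extendable {n k t : ℕ} (V : Allowed (Fin n)) (X : Fin t → Tuples k (Fin n))
    (w : Fin n) : Prop :=
  ∃ a : Fin 2 → ℂ, a ≠ 0 ∧ ∀ l (j : Fin k), Compatible V j w a (X l j)

/-- The values compatible with all parts of `τ`. -/
def compatibleSubmodule {n k : ℕ} (V : Allowed (Fin n)) (w : Fin n)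
    (τ : Tuples k (Fin n)) : Submodule ℂ (Fin 2 → ℂ) where
  carrier := {a | ∀ j : Fin k, Compatible V j w a (τ j)}
  add_mem' ha hb j ψ hψ := by
    simpa using (V (j + 1) _).add_mem (ha j ψ hψ) (hb j ψ hψ)
  zero_mem' j ψ _ := by simp
  smul_mem' c a ha j ψ hψ := by
    simpa using (V (j + 1) _).smul_mem c (ha j ψ hψ)

/-- If many vertices are incompatible with many tuples, then for a large random sample `X` of
tuples it is likely that many vertices are not extendable. -/
lemma card_many_extendable_le {n k t : ℕ} (hn : 0 < n) (V : Allowed (Fin n)) (δ : ℝ)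
    (hδ : 0 < δ) (ht : 16 ≤ t * δ ^ 2)
    (h : δ * n ≤ ((Finset.univ.filter fun w : Fin n => ∀ a : Fin 2 → ℂ, a ≠ 0 →
      ∃ j : Fin k, δ * (n : ℝ) ^ (j : ℕ) ≤ ((Finset.univ.filter fun T : Fin j → Fin n =>
        ¬ Compatible V j w a T).card : ℝ)).card : ℝ)) :
    ((Finset.univ.filter fun X : Fin t → Tuples k (Fin n) =>
      ¬ δ / 2 * n ≤ ((Finset.univ.filter fun w => ¬ Extendable V X w).card : ℝ)).card : ℝ)
      ≤ (Fintype.card (Tuples k (Fin n)) : ℝ) ^ t / 4 := by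
  set bad : Fin n → Prop := fun w => ∀ a : Fin 2 → ℂ, a ≠ 0 →
      ∃ j : Fin k, δ * (n : ℝ) ^ (j : ℕ) ≤ ((Finset.univ.filter fun T : Fin j → Fin n =>
        ¬ Compatible V j w a T).card : ℝ) with hbad
  have hn' : (0 : ℝ) < n := by exact_mod_cast hn
  have htpos : (0 : ℝ) < t := by
    by_contra! h0
    nlinarith [sq_nonneg δ]
  set L := (Fintype.card (Tuples k (Fin n)) : ℝ) with hL
  have hone : ∀ w, ((Finset.univ.filter fun X : Fin t → Tuples k (Fin n) =>
      bad w ∧ Extendable V X w).card : ℝ) ≤ 2 * L ^ t / (t * δ) := by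
    intro w
    by_cases hw : bad w
    · rw [le_div_iff₀ (by positivity)]
      have hchain := card_exists_mem_inf_mul_le (compatibleSubmodule V w (k := k)) {a | a ≠ 0} δ
        hδ.le (fun a ha => by
          obtain ⟨j, hj⟩ := hw a ha
          have hm := card_filter_apply_mul (β := fun j : Fin k => Fin j → Fin n) j
            fun T => ¬ Compatible V j w a T
          rw [Fintype.card_fun, Fintype.card_fin, Fintype.card_fin] at hm
          have hm' : ((Finset.univ.filter fun τ : Tuples k (Fin n) =>
              ¬ Compatible V j w a (τ j)).card : ℝ) * (n : ℝ) ^ (j : ℕ)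
              = ((Finset.univ.filter fun T : Fin j → Fin n =>
                ¬ Compatible V j w a T).card : ℝ) * L := by
            rw [hL]
            exact_mod_cast hm
          have hL0 : 0 ≤ L := by positivity
          have hle : δ * L ≤ ((Finset.univ.filter fun τ : Tuples k (Fin n) =>
              ¬ Compatible V j w a (τ j)).card : ℝ) := by
            refine le_of_mul_le_mul_right ?_ (by positivity : (0 : ℝ) < (n : ℝ) ^ (j : ℕ))
            rw [hm']
            nlinarith [mul_le_mul_of_nonneg_right hj hL0]
          refine hle.trans ?_
          exact_mod_cast Finset.card_le_card fun τ => by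
            simp only [Finset.mem_filter, Finset.mem_univ, true_and]
            exact fun hτ hmem => hτ (hmem j)) t ⊤
      rw [finrank_top, Module.finrank_fin_fun] at hchain
      refine le_trans (mul_le_mul_of_nonneg_right ?_ (by positivity)) hchain
      exact_mod_cast Finset.card_le_card fun X => by
        simp only [Finset.mem_filter, Finset.mem_univ, true_and]
        rintro ⟨_, a, ha, hX⟩
        exact ⟨a, ha, trivial, hX⟩
    · simp only [hw, false_and, Finset.filter_false, Finset.card_empty, Nat.cast_zero]
      positivity
  have hdc := card_mul_le_of_forall_card_le
    (fun X : Fin t → Tuples k (Fin n) =>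
      ¬ δ / 2 * n ≤ ((Finset.univ.filter fun w => ¬ Extendable V X w).card : ℝ))
    (fun X w => bad w ∧ Extendable V X w) (δ / 2 * n) (2 * L ^ t / (t * δ))
    (fun X hX => by
      rw [not_le] at hX
      have hsub : (Finset.univ.filter bad) ⊆
          (Finset.univ.filter fun w => bad w ∧ Extendable V X w)
          ∪ Finset.univ.filter fun w => ¬ Extendable V X w := by
        intro w
        simp only [Finset.mem_filter, Finset.mem_univ, true_and, Finset.mem_union]
        tauto
      have : ((Finset.univ.filter bad).card : ℝ)
          ≤ ((Finset.univ.filter fun w => bad w ∧ Extendable V X w).card : ℝ)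
          + ((Finset.univ.filter fun w => ¬ Extendable V X w).card : ℝ) := by
        exact_mod_cast (Finset.card_le_card hsub).trans (Finset.card_union_le _ _)
      linarith)
    hone
  rw [Fintype.card_fin] at hdc
  have hLt : 0 ≤ L ^ t := by positivity
  refine le_of_mul_le_mul_right ?_ (by positivity : 0 < δ / 2 * n)
  refine hdc.trans ?_
  rw [mul_div_assoc', div_le_iff₀ (by positivity)]
  nlinarith [mul_le_mul_of_nonneg_left ht (mul_nonneg hn'.le hLt)]

/-- The space of the linear conditions that decide whether a vertex is extendable. -/
abbrev FeatureSpace (k t : ℕ) (d : ℕ → ℕ) : Type :=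
  Fin t → ∀ j : Fin k, Tens j →ₗ[ℂ] (Fin (d (j + 1)) → ℂ)

/-- The dimension of the space of alternating conditions on pairs of features. -/
noncomputable def featureDim (k t : ℕ) (d : ℕ → ℕ) : ℕ :=
  Module.finrank ℂ (Module.Dual ℂ (FeatureSpace k t d) →ₗ[ℂ] FeatureSpace k t d)

lemma exists_range_eq {E : Type*} [AddCommGroup E] [Module ℂ E] (p : Submodule ℂ E) :
    ∃ P : E →ₗ[ℂ] E, LinearMap.range P = p := by
  obtain ⟨g, hg⟩ := LinearMap.exists_leftInverse_of_injective p.subtype p.ker_subtype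
  refine ⟨p.subtype ∘ₗ g, le_antisymm ?_ fun x hx => ⟨x, ?_⟩⟩
  · rintro _ ⟨x, rfl⟩
    exact (g x).2
  · exact congrArg Subtype.val (LinearMap.congr_fun hg ⟨x, hx⟩)

/-- Few `r`-tuples consist of vertices that are extendable for a common parameter for which
many vertices are not extendable. -/
lemma card_forall_extendable_le {n k t r : ℕ} {Φ : Type*} (V : Φ → Allowed (Fin n))
    (d : ℕ → ℕ) (e : Φ → ∀ j, Tens j →ₗ[ℂ] (Fin (d j) → ℂ))
    (M : ∀ j, (Fin j → Fin n) → Submodule ℂ (Fin (d j) → ℂ))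
    (hM : ∀ φ j T χ, χ ∈ V φ j T ↔ e φ j χ ∈ M j T)
    (X : Fin t → Tuples k (Fin n)) (δ : ℝ) (hδ : 0 ≤ δ) :
    ((Finset.univ.filter fun B : Fin r → Fin n => ∃ φ,
      δ * n ≤ ((Finset.univ.filter fun w => ¬ Extendable (V φ) X w).card : ℝ) ∧
        ∀ i, Extendable (V φ) X (B i)).card : ℝ) * (r * δ)
      ≤ featureDim k t d * (n : ℝ) ^ r := by
  have hP : ∀ φ (l : Fin t) (j : Fin k), ∃ P : Tens j →ₗ[ℂ] Tens j,
      LinearMap.range P = V φ j (X l j) := fun φ l j => exists_range_eq _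
  choose P hP using hP
  let L : Φ → (Fin 2 → ℂ) → FeatureSpace k t d := fun φ a l j =>
    e φ (j + 1) ∘ₗ tens j a ∘ₗ P φ l j
  have hL : ∀ φ a, L φ a = a 0 • L φ ![1, 0] + a 1 • L φ ![0, 1] := by
    intro φ a
    have ha : a = a 0 • ![1, 0] + a 1 • ![0, 1] := by
      ext i
      fin_cases i <;> simp
    ext1 l
    ext1 j
    refine LinearMap.ext fun χ => ?_
    change e φ (j + 1) (tens j a _) = a 0 • e φ (j + 1) (tens j _ _)
      + a 1 • e φ (j + 1) (tens j _ _)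
    conv_lhs => rw [ha]
    simp only [map_add, map_smul, LinearMap.add_apply, LinearMap.smul_apply]
  let K : Fin n → Submodule ℂ (FeatureSpace k t d) := fun w =>
    { carrier := {h | ∀ l (j : Fin k) χ, h l j χ ∈ M (j + 1) (Fin.cons w (X l j))}
      add_mem' := fun hx hy l j χ => (M _ _).add_mem (hx l j χ) (hy l j χ)
      zero_mem' := fun l j χ => (M _ _).zero_mem
      smul_mem' := fun c x hx l j χ => (M _ _).smul_mem c (hx l j χ) }
  let N : Fin n → Submodule ℂ (Module.Dual ℂ (FeatureSpace k t d) →ₗ[ℂ] FeatureSpace k t d) :=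
    fun w =>
    { carrier := {G | ∀ l ∈ (K w).dualAnnihilator, G l ∈ K w}
      add_mem' := fun hx hy l hl => (K w).add_mem (hx l hl) (hy l hl)
      zero_mem' := fun l _ => (K w).zero_mem
      smul_mem' := fun c x hx l hl => (K w).smul_mem c (hx l hl) }
  let g : Φ → Module.Dual ℂ (FeatureSpace k t d) →ₗ[ℂ] FeatureSpace k t d := fun φ =>
    (Module.Dual.eval ℂ _ (L φ ![1, 0])).smulRight (L φ ![0, 1])
      - (Module.Dual.eval ℂ _ (L φ ![0, 1])).smulRight (L φ ![1, 0])
  have hext : ∀ φ w, Extendable (V φ) X w ↔ g φ ∈ N w := by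
    intro φ w
    have h₁ : Extendable (V φ) X w ↔ ∃ a : Fin 2 → ℂ, a ≠ 0 ∧ L φ a ∈ K w := by
      refine exists_congr fun a => and_congr_right fun _ => forall_congr' fun l =>
        forall_congr' fun j => ?_
      simp only [Compatible, hM φ (j + 1), ← hP φ l j]
      exact ⟨fun h χ => h _ ⟨χ, rfl⟩, fun h ψ ⟨χ, hχ⟩ => hχ ▸ h χ⟩
    rw [h₁, exists_congr fun a => and_congr_right fun _ =>
      iff_of_eq (congrArg (· ∈ K w) (hL φ a)), exists_smul_add_smul_mem_iff]
    rfl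
  have h := card_exists_mem_inf_mul_le N
    {G | ∃ φ, δ * n ≤ ((Finset.univ.filter fun w => ¬ Extendable (V φ) X w).card : ℝ) ∧ g φ = G}
    δ hδ (by
      rintro _ ⟨φ, hφ, rfl⟩
      simpa only [hext, Fintype.card_fin] using hφ) r ⊤
  rw [finrank_top, Fintype.card_fin] at h
  refine le_trans (mul_le_mul_of_nonneg_right ?_ (by positivity)) h
  exact_mod_cast Finset.card_le_card fun B => by
    simp only [Finset.mem_filter, Finset.mem_univ, true_and]
    rintro ⟨φ, hφ, hB⟩
    exact ⟨_, ⟨φ, hφ, rfl⟩, trivial, fun i => (hext φ _).1 (hB i)⟩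

/-- A random block of vertices is unlikely to have values that are compatible with almost all
tuples. -/
lemma card_nearly_compatible_le {n k t r : ℕ} (hn : 0 < n) {Φ : Type*}
    (V : Φ → Allowed (Fin n))
    (d : ℕ → ℕ) (e : Φ → ∀ j, Tens j →ₗ[ℂ] (Fin (d j) → ℂ))
    (M : ∀ j, (Fin j → Fin n) → Submodule ℂ (Fin (d j) → ℂ))
    (hM : ∀ φ j T χ, χ ∈ V φ j T ↔ e φ j χ ∈ M j T) (δ δ₁ : ℝ) (hδ : 0 < δ)
    (ht : 16 ≤ t * δ ^ 2) (hδ₁ : t * δ₁ ≤ 1 / 4) (hr : 0 < r)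
    (h : ∀ φ, δ * n ≤ ((Finset.univ.filter fun w : Fin n => ∀ a : Fin 2 → ℂ, a ≠ 0 →
      ∃ j : Fin k, δ * (n : ℝ) ^ (j : ℕ) ≤ ((Finset.univ.filter fun T : Fin j → Fin n =>
        ¬ Compatible (V φ) j w a T).card : ℝ)).card : ℝ)) :
    ((Finset.univ.filter fun B : Fin r → Fin n => ∃ φ, ∃ l : List (Fin n × (Fin 2 → ℂ)),
      l.map Prod.fst = List.ofFn B ∧ (∀ p ∈ l, p.2 ≠ 0) ∧
      ((Finset.univ.filter fun τ : Tuples k (Fin n) => ∃ j : Fin k, ∃ p ∈ l,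
        ¬ Compatible (V φ) j p.1 p.2 (τ j)).card : ℝ)
        ≤ δ₁ * Fintype.card (Tuples k (Fin n))).card : ℝ)
      ≤ 4 * featureDim k t d / (r * δ) * (n : ℝ) ^ r := by
  have : Nonempty (Fin n) := ⟨⟨0, hn⟩⟩
  set L := (Fintype.card (Tuples k (Fin n)) : ℝ) with hL
  have hLpos : 0 < L := by
    rw [hL]
    exact_mod_cast Fintype.card_pos
  have hr' : (0 : ℝ) < r := by exact_mod_cast hr
  have hdc := card_mul_le_of_forall_card_le
    (fun B : Fin r → Fin n => ∃ φ, ∃ l : List (Fin n × (Fin 2 → ℂ)),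
      l.map Prod.fst = List.ofFn B ∧ (∀ p ∈ l, p.2 ≠ 0) ∧
      ((Finset.univ.filter fun τ : Tuples k (Fin n) => ∃ j : Fin k, ∃ p ∈ l,
        ¬ Compatible (V φ) j p.1 p.2 (τ j)).card : ℝ) ≤ δ₁ * L)
    (fun B (X : Fin t → Tuples k (Fin n)) => ∃ φ,
      δ / 2 * n ≤ ((Finset.univ.filter fun w => ¬ Extendable (V φ) X w).card : ℝ) ∧
        ∀ i, Extendable (V φ) X (B i))
    (L ^ t / 2) (featureDim k t d * (n : ℝ) ^ r / (r * (δ / 2)))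
    (by
      rintro B ⟨φ, l, hl, hne, hτ⟩
      set drop : Tuples k (Fin n) → Prop := fun τ => ∃ j : Fin k, ∃ p ∈ l,
        ¬ Compatible (V φ) j p.1 p.2 (τ j)
      have hA := card_many_extendable_le hn (V φ) δ hδ ht (h φ)
      have hone : ∀ i : Fin t, ((Finset.univ.filter fun X : Fin t → Tuples k (Fin n) =>
          drop (X i)).card : ℝ) ≤ δ₁ * L ^ t := by
        intro i
        have hm := card_filter_apply_mul (β := fun _ : Fin t => Tuples k (Fin n)) i drop
        rw [Fintype.card_fun (α := Fin t), Fintype.card_fin] at hm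
        have hm' : ((Finset.univ.filter fun X : Fin t → Tuples k (Fin n) =>
            drop (X i)).card : ℝ) * L = ((Finset.univ.filter drop).card : ℝ) * L ^ t := by
          rw [hL]
          exact_mod_cast hm
        refine le_of_mul_le_mul_right ?_ hLpos
        rw [hm']
        have : 0 ≤ L ^ t := by positivity
        nlinarith [mul_le_mul_of_nonneg_right hτ this]
      have hsub : (Finset.univ : Finset (Fin t → Tuples k (Fin n))) ⊆
          ((Finset.univ.filter fun X => ∃ φ,
            δ / 2 * n ≤ ((Finset.univ.filter fun w => ¬ Extendable (V φ) X w).card : ℝ) ∧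
              ∀ i, Extendable (V φ) X (B i))
          ∪ Finset.univ.filter fun X =>
            ¬ δ / 2 * n ≤ ((Finset.univ.filter fun w => ¬ Extendable (V φ) X w).card : ℝ))
          ∪ Finset.univ.biUnion fun i => Finset.univ.filter fun X => drop (X i) := by
        intro X _
        simp only [Finset.mem_union, Finset.mem_filter, Finset.mem_univ, true_and,
          Finset.mem_biUnion]
        by_contra! hX
        obtain ⟨⟨h₁, h₂⟩, h₃⟩ := hX
        obtain ⟨i, hi⟩ := h₁ φ h₂
        have hmem : B i ∈ l.map Prod.fst := by
          rw [hl]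
          exact List.mem_ofFn.2 ⟨i, rfl⟩
        obtain ⟨p, hp, hpi⟩ := List.mem_map.1 hmem
        refine hi ⟨p.2, hne p hp, fun s j => ?_⟩
        by_contra hc
        exact h₃ s ⟨j, p, hp, hpi ▸ hc⟩
      have hcard := (Finset.card_le_card hsub).trans ((Finset.card_union_le _ _).trans
        (add_le_add (Finset.card_union_le _ _) Finset.card_biUnion_le))
      rw [Finset.card_univ, Fintype.card_fun, Fintype.card_fin] at hcard
      have hcard' : L ^ t ≤ ((Finset.univ.filter fun X : Fin t → Tuples k (Fin n) => ∃ φ,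
            δ / 2 * n ≤ ((Finset.univ.filter fun w => ¬ Extendable (V φ) X w).card : ℝ) ∧
              ∀ i, Extendable (V φ) X (B i)).card : ℝ)
          + ((Finset.univ.filter fun X : Fin t → Tuples k (Fin n) =>
            ¬ δ / 2 * n ≤ ((Finset.univ.filter fun w => ¬ Extendable (V φ) X w).card : ℝ)).card
              : ℝ)
          + ∑ i : Fin t, ((Finset.univ.filter fun X : Fin t → Tuples k (Fin n) =>
            drop (X i)).card : ℝ) := by
        rw [hL]
        exact_mod_cast hcard
      have hsum := Finset.sum_le_sum fun (i : Fin t) (_ : i ∈ Finset.univ) => hone i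
      rw [Finset.sum_const, Finset.card_univ, Fintype.card_fin, nsmul_eq_mul] at hsum
      have : 0 < L ^ t := by positivity
      nlinarith [mul_le_mul_of_nonneg_right hδ₁ this.le])
    (fun X => by
      rw [le_div_iff₀ (by positivity)]
      exact card_forall_extendable_le V d e M hM X (δ / 2) (by positivity))
  rw [Fintype.card_fun (α := Fin t), Fintype.card_fin] at hdc
  push_cast at hdc
  rw [← hL] at hdc
  refine le_of_mul_le_mul_right (hdc.trans (le_of_eq ?_)) (by positivity : 0 < L ^ t / 2)
  field_simp
  ring

lemma card_filter_append_le {Λ : Type*} [Fintype Λ] {r c : ℕ} (p : (Fin (r + c) → Λ) → Prop)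
    (P : (Fin r → Λ) → Prop) (R : (Fin r → Λ) → (Fin c → Λ) → Prop) (α β : ℝ)
    (hP : ((Finset.univ.filter P).card : ℝ) ≤ α)
    (hR : ∀ u, ((Finset.univ.filter (R u)).card : ℝ) ≤ β)
    (hp : ∀ u v, p (Fin.append u v) → P u ∨ R u v) :
    ((Finset.univ.filter p).card : ℝ)
      ≤ α * (Fintype.card Λ : ℝ) ^ c + (Fintype.card Λ : ℝ) ^ r * β := by
  have h : (Finset.univ.filter p).card ≤
      (((Finset.univ.filter P) ×ˢ (Finset.univ : Finset (Fin c → Λ))) ∪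
        ((Finset.univ : Finset (Fin r → Λ)).sigma fun u => Finset.univ.filter (R u)).map
          (Equiv.sigmaEquivProd _ _).toEmbedding).card := by
    refine Finset.card_le_card_of_injOn (Fin.appendEquiv r c).symm (fun y hy => ?_)
      (Fin.appendEquiv r c).symm.injective.injOn
    obtain ⟨⟨u, v⟩, rfl⟩ := (Fin.appendEquiv r c).surjective y
    have := hp u v (Finset.mem_filter.1 hy).2
    simpa using this
  have h' := h.trans (Finset.card_union_le _ _)
  rw [Finset.card_product, Finset.card_map, Finset.card_sigma, Finset.card_univ,
    Fintype.card_fun, Fintype.card_fin] at h'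
  calc ((Finset.univ.filter p).card : ℝ)
      ≤ ((Finset.univ.filter P).card : ℝ) * (Fintype.card Λ : ℝ) ^ c
        + ∑ u, ((Finset.univ.filter (R u)).card : ℝ) := by exact_mod_cast h'
    _ ≤ α * (Fintype.card Λ : ℝ) ^ c + ∑ _u : Fin r → Λ, β :=
        add_le_add (mul_le_mul_of_nonneg_right hP (by positivity))
          (Finset.sum_le_sum fun u _ => hR u)
    _ = _ := by simp

/-- Most `c`-tuples of vertices have no assignment that is consistent with a given assignment
leaving only small allowed subspaces on average. This is proved by induction on the bound `m`
for this average, at each step of which a block of vertices is assigned that is likely to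
decrease it. -/
lemma exists_card_consistent_le {k t : ℕ} {ε δ δ₁ η : ℝ} (hδ : 0 < δ) (hεδ : 2 * k * δ < ε)
    (ht : 16 ≤ t * δ ^ 2) (hδ₁ : t * δ₁ ≤ 1 / 4) (hη : 0 < η) (m : ℕ) :
    ∀ q : ℕ, ∃ c : ℕ, ∀ n : ℕ, 0 < n → ∀ V : Allowed (Fin n),
      (∀ φ : Fin n → Fin 2 → ℂ, (∀ i, φ i ≠ 0) → ε * (n : ℝ) ^ k ≤
        ((Finset.univ.filter fun x : Fin k → Fin n =>
          prodVec (fun i => φ (x i)) ∉ V k x).card : ℝ)) →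
      ∀ S : List (Fin n), S.length = q →
        ((Finset.univ.filter fun y : Fin c → Fin n => ∃ l l' : List (Fin n × (Fin 2 → ℂ)),
          l.map Prod.fst = S ∧ l'.map Prod.fst = List.ofFn y ∧ (∀ p ∈ l', p.2 ≠ 0) ∧
          (1 : Tens 0) ∈ assignAll V (l ++ l') 0 Fin.elim0 ∧
          (∑ τ : Tuples k (Fin n), (totalDim k (assignAll V l) τ : ℝ))
            < m * δ₁ * Fintype.card (Tuples k (Fin n))).card : ℝ) ≤ m * η * (n : ℝ) ^ c := by
  induction m with
  | zero =>
    refine fun q => ⟨0, fun n _ V _ S _ => ?_⟩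
    rw [Finset.filter_eq_empty_iff.2]
    · simp
    · rintro y _ ⟨l, l', -, -, -, -, h⟩
      have : 0 ≤ ∑ τ : Tuples k (Fin n), (totalDim k (assignAll V l) τ : ℝ) := by positivity
      simp only [Nat.cast_zero, zero_mul] at h
      linarith
  | succ m ih =>
    intro q
    obtain ⟨d, hd⟩ := exists_features q
    obtain ⟨r, hr⟩ := exists_nat_gt (4 * featureDim k t d / (η * δ))
    have hr0 : (0 : ℝ) < r := lt_of_le_of_lt (by positivity) hr
    have hrη : 4 * featureDim k t d / (r * δ) ≤ η := by
      rw [div_lt_iff₀ (by positivity)] at hr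
      rw [div_le_iff₀ (by positivity)]
      linarith
    obtain ⟨c, hc⟩ := ih (q + r)
    refine ⟨r + c, fun n hn V hV S hS => ?_⟩
    obtain ⟨e, M, hM⟩ := hd (Fin n) V S hS
    have hfew := card_nearly_compatible_le (k := k) (t := t) (r := r) hn
      (fun φ : { l : List (Fin n × (Fin 2 → ℂ)) //
        l.map Prod.fst = S ∧ (1 : Tens 0) ∈ assignAll V l 0 Fin.elim0 } => assignAll V φ.1)
      d (fun φ => e φ.1) M (fun φ => hM φ.1 φ.2.1) δ δ₁ hδ ht hδ₁ (by exact_mod_cast hr0)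
      (fun φ => card_incompatible_ge hn _ ε δ hδ.le hεδ φ.2.2 fun ψ hψ =>
        (hV ψ hψ).trans <| Nat.cast_le.2 <| Finset.card_le_card <|
          Finset.monotone_filter_right _ fun x _ hx hx' => hx (assignAll_le V φ.1 k x hx'))
    have hrest := fun u : Fin r → Fin n => hc n hn V hV (S ++ List.ofFn u) (by simp [hS])
    refine (card_filter_append_le _ _ _ _ _ hfew hrest ?_).trans ?_
    · rintro u v ⟨l, l', hl, hl', hne, h1, hsum⟩
      rw [List.ofFn_fin_append, List.map_eq_append_iff] at hl'
      obtain ⟨l₁, l₂, rfl, hl₁, hl₂⟩ := hl'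
      rw [← List.append_assoc] at h1
      by_cases hm : (∑ τ : Tuples k (Fin n), (totalDim k (assignAll V (l ++ l₁)) τ : ℝ))
          < m * δ₁ * Fintype.card (Tuples k (Fin n))
      · exact Or.inr ⟨l ++ l₁, l₂, by simp [hl, hl₁], hl₂,
          fun p hp => hne p (List.mem_append_right _ hp), h1, hm⟩
      · refine Or.inl ⟨⟨l, hl, ?_⟩, l₁, hl₁, fun p hp => hne p (List.mem_append_left _ hp), ?_⟩
        · rw [List.append_assoc, assignAll_append] at h1
          exact assignAll_le _ _ _ _ h1
        · have hstep : ∀ τ : Tuples k (Fin n),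
              (if ∃ j : Fin k, ∃ p ∈ l₁, ¬ Compatible (assignAll V l) j p.1 p.2 (τ j)
                then (1 : ℝ) else 0)
              ≤ totalDim k (assignAll V l) τ - totalDim k (assignAll V (l ++ l₁)) τ := by
            intro τ
            have hle : assignAll V (l ++ l₁) ≤ assignAll V l := by
              rw [assignAll_append]
              exact assignAll_le _ _
            split_ifs with hτ
            · obtain ⟨j, p, hp, hcomp⟩ := hτ
              have := totalDim_lt hle τ (j := j) fun hj => hcomp
                (compatible_of_le_assignAll (by rwa [assignAll_append] at hj) hp)
              have : (totalDim k (assignAll V (l ++ l₁)) τ : ℝ) + 1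
                ≤ totalDim k (assignAll V l) τ := by exact_mod_cast this
              linarith
            · have : (totalDim k (assignAll V (l ++ l₁)) τ : ℝ)
                ≤ totalDim k (assignAll V l) τ := by exact_mod_cast totalDim_mono hle τ
              linarith
          have hs := Finset.sum_le_sum fun τ (_ : τ ∈ Finset.univ) => hstep τ
          rw [Finset.sum_boole, Finset.sum_sub_distrib] at hs
          push_cast at hsum
          linarith
    · rw [Fintype.card_fin, pow_add]
      have : 0 ≤ (n : ℝ) ^ r * (n : ℝ) ^ c := by positivity
      push_cast
      nlinarith [mul_le_mul_of_nonneg_right hrη this]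

/-- If every global assignment violates many constraints, then most `c`-tuples of vertices
have no consistent assignment. -/
lemma exists_forall_card_consistent_le (k : ℕ) {ε η : ℝ} (hε : 0 < ε) (hη : 0 < η) :
    ∃ c : ℕ, ∀ n : ℕ, 0 < n → ∀ V : Allowed (Fin n),
      (∀ φ : Fin n → Fin 2 → ℂ, (∀ i, φ i ≠ 0) → ε * (n : ℝ) ^ k ≤
        ((Finset.univ.filter fun x : Fin k → Fin n =>
          prodVec (fun i => φ (x i)) ∉ V k x).card : ℝ)) →
      ((Finset.univ.filter fun y : Fin c → Fin n => ∃ l : List (Fin n × (Fin 2 → ℂ)),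
        l.map Prod.fst = List.ofFn y ∧ (∀ p ∈ l, p.2 ≠ 0) ∧
        (1 : Tens 0) ∈ assignAll V l 0 Fin.elim0).card : ℝ) ≤ η * (n : ℝ) ^ c := by
  obtain ⟨δ, hδ, hεδ⟩ : ∃ δ : ℝ, 0 < δ ∧ 2 * k * δ < ε := by
    refine ⟨ε / (2 * k + 1), by positivity, ?_⟩
    rw [mul_div_assoc', div_lt_iff₀ (by positivity)]
    nlinarith
  obtain ⟨t, ht⟩ := exists_nat_ge (16 / δ ^ 2)
  rw [div_le_iff₀ (by positivity)] at ht
  have ht0 : (0 : ℝ) < t := by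
    by_contra! h0
    nlinarith [sq_nonneg δ]
  obtain ⟨m, hm⟩ := exists_nat_gt ((k * 2 ^ k : ℕ) / (1 / (4 * t) : ℝ))
  have hm0 : (0 : ℝ) < m := lt_of_le_of_lt (by positivity) hm
  rw [div_lt_iff₀ (by positivity)] at hm
  obtain ⟨c, hc⟩ := exists_card_consistent_le hδ hεδ ht
    (δ₁ := 1 / (4 * t)) (by field_simp; rfl) (div_pos hη hm0) m 0
  refine ⟨c, fun n hn V hV => ?_⟩
  have h := hc n hn V hV [] rfl
  rw [mul_div_cancel₀ _ hm0.ne'] at h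
  refine le_trans ?_ h
  have : Nonempty (Fin n) := ⟨⟨0, hn⟩⟩
  refine Nat.cast_le.2 <| Finset.card_le_card <| Finset.monotone_filter_right _ fun y _ => ?_
  · rintro ⟨l, hl, hne, h1⟩
    refine ⟨[], l, rfl, hl, hne, h1, ?_⟩
    calc (∑ τ : Tuples k (Fin n), (totalDim k (assignAll V []) τ : ℝ))
        ≤ ∑ _τ : Tuples k (Fin n), ((k * 2 ^ k : ℕ) : ℝ) :=
          Finset.sum_le_sum fun τ _ => by exact_mod_cast totalDim_le k _ τ
      _ < _ := by
          rw [Finset.sum_const, Finset.card_univ, nsmul_eq_mul, mul_comm]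
          exact mul_lt_mul_of_pos_right hm (by exact_mod_cast Fintype.card_pos)

/-- The bit string that agrees with `h` on `s` and with `f` outside of `s`. -/
noncomputable def override {n : ℕ} {s C : Finset (Fin n)} (f : ↥C → Fin 2) (h : ↥s → Fin 2) :
    ↥C → Fin 2 :=
  fun i => if hi : (i : Fin n) ∈ s then h ⟨i, hi⟩ else f i

section extendOp

variable {n : ℕ} {s C : Finset (Fin n)}

lemma extendOp_mulVec_apply (hs : s ⊆ C) (K : Matrix (↥s → Fin 2) (↥s → Fin 2) ℂ)
    (ψ : QVec n C) (f : ↥C → Fin 2) :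
    (extendOp s C K).mulVec ψ f
      = ∑ h, K (fun j => f ⟨j.1, hs j.2⟩) h * ψ (override f h) := by
  simp only [Matrix.mulVec, dotProduct, extendOp, Matrix.of_apply, dif_pos hs, ite_mul, zero_mul]
  rw [← Finset.sum_filter]
  refine Finset.sum_nbij' (fun g j => g ⟨j.1, hs j.2⟩) (override f) ?_ ?_ ?_ ?_ ?_
  · simp
  · intro h _
    simp +contextual [override]
  · intro g hg
    ext1 i
    by_cases hi : (i : Fin n) ∈ s
    · simp [override, hi]
    · simp [override, hi, (Finset.mem_filter.1 hg).2 i hi]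
  · intro h _
    ext1 j
    simp [override]
  · intro g hg
    congr 2
    ext1 i
    by_cases hi : (i : Fin n) ∈ s
    · simp [override, hi]
    · simp [override, hi, (Finset.mem_filter.1 hg).2 i hi]

lemma isHermitian_extendOp {K : Matrix (↥s → Fin 2) (↥s → Fin 2) ℂ} (hK : K.IsHermitian) :
    (extendOp s C K).IsHermitian := by
  ext f g
  simp only [extendOp, Matrix.conjTranspose_apply, Matrix.of_apply]
  by_cases hs : s ⊆ C
  · simp only [dif_pos hs, eq_comm (a := g _) (b := f _)]
    split_ifs
    · exact hK.apply _ _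
    · exact star_zero _
  · simp [hs]

lemma extendOp_mul_self (hs : s ⊆ C) {K : Matrix (↥s → Fin 2) (↥s → Fin 2) ℂ}
    (hK : K * K = K) : extendOp s C K * extendOp s C K = extendOp s C K := by
  refine Matrix.ext_of_mulVec_single fun i => ?_
  generalize (Pi.single i 1 : (↥C → Fin 2) → ℂ) = ψ
  ext f
  rw [← Matrix.mulVec_mulVec, extendOp_mulVec_apply hs, extendOp_mulVec_apply hs]
  have h₁ : ∀ h : ↥s → Fin 2, (fun j : ↥s => override f h ⟨j.1, hs j.2⟩) = h := by
    intro h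
    ext1 j
    simp [override]
  have h₂ : ∀ h h' : ↥s → Fin 2, override (override f h) h' = override f h' := by
    intro h h'
    ext1 i
    by_cases hi : (i : Fin n) ∈ s <;> simp [override, hi]
  simp only [extendOp_mulVec_apply hs, h₁, h₂, Finset.mul_sum]
  rw [Finset.sum_comm]
  refine Finset.sum_congr rfl fun h' _ => ?_
  conv_rhs => rw [← hK]
  simp only [Matrix.mul_apply, Finset.sum_mul, mul_assoc]

open scoped ComplexOrder in
lemma posSemidef_extendOp (hs : s ⊆ C) {K : Matrix (↥s → Fin 2) (↥s → Fin 2) ℂ}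
    (hK : K.IsHermitian) (hK' : K * K = K) : (extendOp s C K).PosSemidef := by
  have h := Matrix.posSemidef_conjTranspose_mul_self (extendOp s C K)
  rwa [isHermitian_extendOp hK, extendOp_mul_self hs hK'] at h

lemma extendOp_mulVec_prodVec (hs : s ⊆ C) (K : Matrix (↥s → Fin 2) (↥s → Fin 2) ℂ)
    (φ : Fin n → Fin 2 → ℂ) (f : ↥C → Fin 2) :
    (extendOp s C K).mulVec (prodVec fun i : ↥C => φ i) f
      = K.mulVec (prodVec fun i : ↥s => φ i) (fun j => f ⟨j.1, hs j.2⟩)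
        * ∏ i : ↥C, if (i : Fin n) ∈ s then 1 else φ i (f i) := by
  rw [extendOp_mulVec_apply hs, Matrix.mulVec, dotProduct, Finset.sum_mul]
  refine Finset.sum_congr rfl fun h _ => ?_
  rw [mul_assoc]
  congr 1
  have hprod : ∏ j : ↥s, φ j (h j)
      = ∏ i : ↥C, if hi : (i : Fin n) ∈ s then φ i (h ⟨i, hi⟩) else 1 := by
    refine (Fintype.prod_of_injective (fun j : ↥s => (⟨j.1, hs j.2⟩ : ↥C))
      (fun a b hab => Subtype.ext (congrArg (fun i : ↥C => (i : Fin n)) hab)) _ _ ?_ ?_)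
    · intro i hi
      exact dif_neg fun hi' => hi ⟨⟨i, hi'⟩, rfl⟩
    · intro j
      simp
  rw [prodVec, prodVec, hprod, ← Finset.prod_mul_distrib]
  refine Finset.prod_congr rfl fun i _ => ?_
  by_cases hi : (i : Fin n) ∈ s <;> simp [override, hi]

lemma extendOp_mulVec_prodVec_eq_zero_iff (hs : s ⊆ C)
    (K : Matrix (↥s → Fin 2) (↥s → Fin 2) ℂ) (φ : Fin n → Fin 2 → ℂ) (hφ : ∀ i, φ i ≠ 0) :
    (extendOp s C K).mulVec (prodVec fun i : ↥C => φ i) = 0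
      ↔ K.mulVec (prodVec fun i : ↥s => φ i) = 0 := by
  constructor
  · intro h
    ext f
    choose g hg using fun i => Function.ne_iff.1 (hφ i)
    have := congrFun h (override (fun i => g i) f)
    rw [extendOp_mulVec_prodVec hs] at this
    have hf : (fun j : ↥s => override (C := C) (fun i => g i) f ⟨j.1, hs j.2⟩) = f := by
      ext1 j
      simp [override]
    rw [hf] at this
    refine (mul_eq_zero.1 this).resolve_right (Finset.prod_ne_zero_iff.2 fun i _ => ?_)
    split_ifs with hi
    · exact one_ne_zero
    · simpa [override, hi] using hg i
  · intro h
    ext f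
    rw [extendOp_mulVec_prodVec hs, h]
    simp

end extendOp

variable {n k : ℕ}

open scoped ComplexOrder in
lemma constraintSum_eq_zero_iff (I : Instance n k) (C : Finset (Fin n)) (ψ : QVec n C) :
    constraintSum I C ψ = 0
      ↔ ∀ s ∈ Finset.powersetCard k C, (extendOp s C (I.K s)).mulVec ψ = 0 := by
  refine ⟨fun h => ?_, fun h => Finset.sum_eq_zero h⟩
  have hpos : ∀ s ∈ Finset.powersetCard k C, (extendOp s C (I.K s)).PosSemidef := by
    intro s hs
    obtain ⟨hsC, hsk⟩ := Finset.mem_powersetCard.1 hs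
    exact posSemidef_extendOp hsC (I.isHermitian s hsk) (I.isIdempotent s hsk)
  have h0 := congrArg (fun v => star ψ ⬝ᵥ v) h
  simp only [constraintSum, dotProduct_sum, dotProduct_zero] at h0
  rw [Finset.sum_eq_zero_iff_of_nonneg fun s hs => (hpos s hs).dotProduct_mulVec_nonneg ψ] at h0
  exact fun s hs => ((hpos s hs).dotProduct_mulVec_zero_iff ψ).1 (h0 s hs)

/-- The tensors on a `k`-tuple of distinct qubits that satisfy the constraint of the instance
on these qubits. -/
noncomputable def allowed (I : Instance n k) : Allowed (Fin n) := fun j x =>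
  if j = k ∧ Function.Injective x then
    LinearMap.ker ((I.K (Finset.univ.image x)).mulVecLin ∘ₗ LinearMap.funLeft ℂ ℂ
      fun (f : ↥(Finset.univ.image x) → Fin 2) i =>
        f ⟨x i, Finset.mem_image_of_mem x (Finset.mem_univ i)⟩)
  else ⊤

lemma prodVec_mem_allowed_iff (I : Instance n k) (φ : Fin n → Fin 2 → ℂ) {j : ℕ}
    (x : Fin j → Fin n) :
    prodVec (fun i => φ (x i)) ∈ allowed I j x ↔ (j = k → Function.Injective x →
      (I.K (Finset.univ.image x)).mulVec
        (prodVec fun i : ↥(Finset.univ.image x) => φ i) = 0) := by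
  rw [allowed]
  split_ifs with h
  · have hx : LinearMap.funLeft ℂ ℂ (fun (f : ↥(Finset.univ.image x) → Fin 2) i =>
        f ⟨x i, Finset.mem_image_of_mem x (Finset.mem_univ i)⟩) (prodVec fun i => φ (x i))
        = prodVec fun i : ↥(Finset.univ.image x) => φ i := by
      ext f
      refine Function.Bijective.prod_comp (e := fun i => (⟨x i, Finset.mem_image_of_mem x
        (Finset.mem_univ i)⟩ : ↥(Finset.univ.image x))) ⟨fun a b hab => h.2 ?_, ?_⟩
        (fun i : ↥(Finset.univ.image x) => φ i (f i))
      · exact congrArg Subtype.val hab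
      · rintro ⟨v, hv⟩
        obtain ⟨i, -, rfl⟩ := Finset.mem_image.1 hv
        exact ⟨i, rfl⟩
    simp [h.1, h.2, hx]
  · simp only [Submodule.mem_top, true_iff]
    exact fun h₁ h₂ => absurd ⟨h₁, h₂⟩ h

lemma le_card_prodVec_notMem_allowed {I : Instance n k} {ε : ℝ} (hI : EpsFarFromProdSat I ε)
    (φ : Fin n → Fin 2 → ℂ) (hφ : ∀ i, φ i ≠ 0) :
    ε * (n : ℝ) ^ k ≤ ((Finset.univ.filter fun x : Fin k → Fin n =>
      prodVec (fun i => φ (x i)) ∉ allowed I k x).card : ℝ) := by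
  refine (hI ((Finset.univ.filter fun x : Fin k → Fin n =>
    prodVec (fun i => φ (x i)) ∉ allowed I k x).image fun x => Finset.univ.image x)
    ⟨fun i => φ i, fun i => hφ i, Finset.sum_eq_zero fun s hs => ?_⟩).trans
    (Nat.cast_le.2 Finset.card_image_le)
  obtain ⟨hs, hs'⟩ := Finset.mem_sdiff.1 hs
  obtain ⟨x, hx, rfl⟩ : ∃ x : Fin k → Fin n, Function.Injective x ∧ Finset.univ.image x = s :=
    ⟨s.orderEmbOfFin (Finset.mem_powersetCard.1 hs).2, RelEmbedding.injective _, by simp⟩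
  rw [extendOp_mulVec_prodVec_eq_zero_iff (Finset.subset_univ _) _ _ hφ]
  by_contra h
  exact hs' (Finset.mem_image_of_mem _ (Finset.mem_filter.2 ⟨Finset.mem_univ x,
    fun hmem => h ((prodVec_mem_allowed_iff I φ x).1 hmem rfl hx)⟩))

lemma ProdSatisfiableAt.exists_assignAll {I : Instance n k} {C : Finset (Fin n)}
    (h : ProdSatisfiableAt I C) {c : ℕ} (y : Fin c → Fin n) (hy : ∀ i, y i ∈ C) :
    ∃ l : List (Fin n × (Fin 2 → ℂ)), l.map Prod.fst = List.ofFn y ∧ (∀ p ∈ l, p.2 ≠ 0) ∧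
      (1 : Tens 0) ∈ assignAll (allowed I) l 0 Fin.elim0 := by
  obtain ⟨φ', hφ', hsat⟩ := h
  obtain ⟨φ, hφ, rfl⟩ : ∃ φ : Fin n → Fin 2 → ℂ, (∀ i, φ i ≠ 0) ∧ φ' = fun i : ↥C => φ i := by
    refine ⟨fun i => if hi : i ∈ C then φ' ⟨i, hi⟩ else 1, fun i => ?_, ?_⟩
    · dsimp only
      split_ifs
      · exact hφ' _
      · exact one_ne_zero
    · ext1 i
      simp
  rw [constraintSum_eq_zero_iff] at hsat
  refine ⟨List.ofFn fun i => (y i, φ (y i)), by simp [List.map_ofFn, Function.comp_def], ?_, ?_⟩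
  · intro p hp
    obtain ⟨i, rfl⟩ := List.mem_ofFn.1 hp
    exact hφ _
  · have := prodVec_mem_assignAll (V := allowed I) φ (C : Set (Fin n))
      (List.ofFn fun i => (y i, φ (y i)))
      (fun p hp => by
        obtain ⟨i, rfl⟩ := List.mem_ofFn.1 hp
        exact ⟨hy i, rfl⟩)
      (fun j T hT => (prodVec_mem_allowed_iff I φ T).2 fun hj hT' => by
        have hsub : Finset.univ.image T ⊆ C := by
          intro v hv
          obtain ⟨i, -, rfl⟩ := Finset.mem_image.1 hv
          exact hT i
        rw [← extendOp_mulVec_prodVec_eq_zero_iff hsub _ φ hφ]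
        refine hsat _ (Finset.mem_powersetCard.2 ⟨hsub, ?_⟩)
        rw [Finset.card_image_of_injective _ hT', Finset.card_univ, Fintype.card_fin, hj])
      Fin.elim0 (fun i => i.elim0)
    have e : prodVec (fun i : Fin 0 => φ (Fin.elim0 i)) = 1 := by
      ext f
      simp [prodVec]
    rwa [← e]

/-- Every `c`-element set is the image of `c!` injective `c`-tuples. -/
lemma card_mul_factorial_le {c : ℕ} (A : Finset (Finset (Fin n))) (hA : ∀ C ∈ A, C.card = c)
    (p : (Fin c → Fin n) → Prop) (hp : ∀ C ∈ A, ∀ y : Fin c → Fin n, (∀ i, y i ∈ C) → p y) :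
    A.card * c.factorial ≤ (Finset.univ.filter p).card := by
  have h := Finset.card_mul_le_card_mul (s := A) (t := Finset.univ.filter p)
    (fun C y => Finset.univ.image y = C) (m := c.factorial) (n := 1) ?_ ?_
  · simpa using h
  · intro C hC
    have hperm : c.factorial = (Finset.univ : Finset (Equiv.Perm (Fin c))).card := by
      rw [Finset.card_univ, Fintype.card_perm, Fintype.card_fin]
    rw [hperm]
    refine Finset.card_le_card_of_injOn (fun σ i => C.orderEmbOfFin (hA C hC) (σ i))
      (fun σ _ => ?_) fun σ _ σ' _ h => ?_
    · refine (Finset.mem_bipartiteAbove _).2 ⟨Finset.mem_filter.2 ⟨Finset.mem_univ _,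
        hp C hC _ fun i => Finset.orderEmbOfFin_mem _ _ _⟩, ?_⟩
      have := Finset.image_image (s := Finset.univ) (f := σ) (g := C.orderEmbOfFin (hA C hC))
      simpa [Function.comp_def] using this.symm
    · ext1 i
      exact (C.orderEmbOfFin (hA C hC)).injective (congrFun h i)
  · intro y _
    refine Finset.card_le_one.2 fun C hC C' hC' => ?_
    exact ((Finset.mem_bipartiteBelow _).1 hC).2.symm.trans ((Finset.mem_bipartiteBelow _).1 hC').2

lemma pow_le_two_mul_choose_mul_factorial {c n : ℕ} (h : 2 * c ^ 2 < n) :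
    (n : ℝ) ^ c ≤ 2 * (n.choose c * c.factorial) := by
  have hn : (0 : ℝ) < n := by exact_mod_cast Nat.zero_lt_of_lt h
  have hcn : c ≤ n := by nlinarith
  have hb := one_add_mul_le_pow (a := -(c / n : ℝ))
    (by
      have : (c / n : ℝ) ≤ 1 := (div_le_one hn).2 (by exact_mod_cast hcn)
      linarith) c
  have hc2 : (c : ℝ) * (c / n) ≤ 1 / 2 := by
    rw [mul_div_assoc', div_le_iff₀ hn]
    have : (2 * c ^ 2 : ℝ) < n := by exact_mod_cast h
    nlinarith
  have hd : ((n - c : ℕ) : ℝ) ^ c ≤ n.descFactorial c := by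
    exact_mod_cast (Nat.pow_le_pow_left (by omega) c).trans (Nat.pow_sub_le_descFactorial n c)
  rw [Nat.cast_sub hcn] at hd
  have he : ((n : ℝ) - c) ^ c = (1 + -(c / n : ℝ)) ^ c * (n : ℝ) ^ c := by
    rw [← mul_pow]
    congr 1
    field_simp
    ring
  rw [he] at hd
  have hf : (n.descFactorial c : ℝ) = n.choose c * c.factorial := by
    rw [Nat.descFactorial_eq_factorial_mul_choose]
    push_cast
    ring
  rw [← hf]
  have : (0 : ℝ) < (n : ℝ) ^ c := by positivity
  nlinarith

/-- **Theorem 2 (local unsatisfiability).**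
For every `k` and `ε > 0` there is a constant `c = c(k,ε)` (not depending on `n`) and a
threshold `N` such that for all `n ≥ N`: if an instance of quantum `k`-SAT on `n` qubits is
`ε`-far from satisfiable by a product state, then the number of `c`-element subsets `C` of
the qubits at which the instance is locally unsatisfiable by a product state is greater
than `0.75 · C(n,c)`; equivalently, a uniformly random `C ∈ σ_c([n])` is locally
unsatisfiable by a product state with probability greater than `0.75`. -/
theorem locally_prod_unsatisfiable_of_far (k : ℕ) (ε : ℝ) (hε : 0 < ε) :
    ∃ c N : ℕ, ∀ n : ℕ, N ≤ n → ∀ I : Instance n k, EpsFarFromProdSat I ε →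
      (0.75 : ℝ) * (n.choose c : ℝ) <
        (((Finset.powersetCard c (Finset.univ : Finset (Fin n))).filter
          (fun C => ¬ ProdSatisfiableAt I C)).card : ℝ) := by
  obtain ⟨c, hc⟩ := exists_forall_card_consistent_le k hε (η := 1 / 16) (by norm_num)
  refine ⟨c, 2 * c ^ 2 + 1, fun n hn I hI => ?_⟩
  have hn' : 2 * c ^ 2 < n := hn
  have hcons := hc n (Nat.zero_lt_of_lt hn') (allowed I)
    (le_card_prodVec_notMem_allowed hI)
  set A := Finset.powersetCard c (Finset.univ : Finset (Fin n)) with hA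
  have hsat := card_mul_factorial_le (A.filter fun C => ProdSatisfiableAt I C)
    (fun C hC => (Finset.mem_powersetCard.1 (Finset.mem_filter.1 hC).1).2) _
    (fun C hC y hy => (Finset.mem_filter.1 hC).2.exists_assignAll y hy)
  have hsat' : ((A.filter fun C => ProdSatisfiableAt I C).card : ℝ) * c.factorial
      ≤ 1 / 16 * (n : ℝ) ^ c := le_trans (by exact_mod_cast hsat) hcons
  have hpow := pow_le_two_mul_choose_mul_factorial hn'
  have hfac : (0 : ℝ) < c.factorial := by exact_mod_cast c.factorial_pos
  have hle : ((A.filter fun C => ProdSatisfiableAt I C).card : ℝ) ≤ 1 / 8 * n.choose c := by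
    refine le_of_mul_le_mul_right ?_ hfac
    linarith
  have hsplit := Finset.card_filter_add_card_filter_not (s := A)
    (fun C => ProdSatisfiableAt I C)
  rw [hA, Finset.card_powersetCard, Finset.card_univ, Fintype.card_fin, ← hA] at hsplit
  have hsplit' : ((A.filter fun C => ProdSatisfiableAt I C).card : ℝ)
      + ((A.filter fun C => ¬ ProdSatisfiableAt I C).card : ℝ) = n.choose c := by
    exact_mod_cast hsplit
  have hpos : (0 : ℝ) < n.choose c := by
    exact_mod_cast Nat.choose_pos (by nlinarith)
  norm_num
  linarith

end QkSAT
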